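/- arXiv:0911.0412 — 2 statements merged into one kernel-verified Lean document; each statement's English description precedes it below -/
import Mathlib

section
/- Let M denote the set of I×J probability matrices of rank at most 2 (equivalently, of nonnegative rank at most 2). Then M is covered by the images of the maps f_{j_1,j_2} for 1 ≤ j_1 < j_2 ≤ J: for every P ∈ M there exist indices j_1 < j_2 and a parameter point P' ∈ U'_{j_1,j_2} with f_{j_1,j_2}(P') = P. -/
/-- Column vector (a_1, …, a_{I-1}, 1 - Σ a_i) ∈ ℝ^{I+1}. -/
def colVec {I : ℕ} (a : Fin I → ℝ) : Fin (I + 1) → ℝ :=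
  Fin.snoc a (1 - ∑ i, a i)

/-- The complement of the two chosen column indices, in increasing order. -/
lemma card_erase_two {J : ℕ} (j₁ j₂ : Fin (J + 2)) (h : j₁ < j₂) :
    ((Finset.univ.erase j₁).erase j₂).card = J := by
  rw [Finset.card_erase_of_mem (by simp [Finset.mem_erase, h.ne']),
    Finset.card_erase_of_mem (by simp)]
  simp

/-- The row vector with entry `x₁` in position j₁, entry `x₂` in position j₂, and the
entries of `b` filling the remaining positions in increasing order. -/
noncomputable def rowGen {J : ℕ} (j₁ j₂ : Fin (J + 2)) (h : j₁ < j₂)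
    (x₁ x₂ : ℝ) (b : Fin J → ℝ) : Fin (J + 2) → ℝ := fun j =>
  if hj₁ : j = j₁ then x₁
  else if hj₂ : j = j₂ then x₂
  else b ((((Finset.univ.erase j₁).erase j₂).orderIsoOfFin
      (card_erase_two j₁ j₂ h)).symm ⟨j, by simp [Finset.mem_erase, hj₁, hj₂]⟩)

/-- The parametrization map f_{j₁,j₂}: sends (a, b, c, d, α) to the matrix
α·u·vᵗ + (1-α)·w·zᵗ, where v has entry 1-Σb in position j₁, entry 0 in position j₂ and
entries b_3,…,b_J in the remaining positions in order, and z has entry 0 in position j₁,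
entry 1-Σd in position j₂ and entries d_3,…,d_J in the remaining positions in order. -/
noncomputable def fGen {I J : ℕ} (j₁ j₂ : Fin (J + 2)) (h : j₁ < j₂)
    (a : Fin I → ℝ) (b : Fin J → ℝ) (c : Fin I → ℝ) (d : Fin J → ℝ) (α : ℝ) :
    Matrix (Fin (I + 1)) (Fin (J + 2)) ℝ :=
  fun i j => α * colVec a i * rowGen j₁ j₂ h (1 - ∑ k, b k) 0 b j +
    (1 - α) * colVec c i * rowGen j₁ j₂ h 0 (1 - ∑ k, d k) d j

/-- The domain U'_{j₁,j₂}. -/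
def memU {I J : ℕ} (a : Fin I → ℝ) (b : Fin J → ℝ) (c : Fin I → ℝ) (d : Fin J → ℝ)
    (α : ℝ) : Prop :=
  (∀ i, 0 ≤ a i ∧ a i ≤ 1) ∧ (∀ j, 0 ≤ b j ∧ b j ≤ 1) ∧
  (∀ i, 0 ≤ c i ∧ c i ≤ 1) ∧ (∀ j, 0 ≤ d j ∧ d j ≤ 1) ∧
  (0 ≤ α ∧ α ≤ 1) ∧
  (0 ≤ ∑ i, a i ∧ ∑ i, a i ≤ 1) ∧ (0 ≤ ∑ j, b j ∧ ∑ j, b j ≤ 1) ∧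
  (0 ≤ ∑ i, c i ∧ ∑ i, c i ≤ 1) ∧ (0 ≤ ∑ j, d j ∧ ∑ j, d j ≤ 1)

/-- Three dependent nonnegative vectors: one of them lies in the cone of the other two. -/
lemma aux_three {ι : Type*} (x y z : ι → ℝ) (hx : ∀ i, 0 ≤ x i) (hy : ∀ i, 0 ≤ y i)
    (hz : ∀ i, 0 ≤ z i) (r s t : ℝ) (hne : r ≠ 0 ∨ s ≠ 0 ∨ t ≠ 0)
    (h : ∀ i, r * x i + s * y i + t * z i = 0) :
    (∃ p q : ℝ, 0 ≤ p ∧ 0 ≤ q ∧ ∀ i, x i = p * y i + q * z i) ∨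
    (∃ p q : ℝ, 0 ≤ p ∧ 0 ≤ q ∧ ∀ i, y i = p * x i + q * z i) ∨
    (∃ p q : ℝ, 0 ≤ p ∧ 0 ≤ q ∧ ∀ i, z i = p * x i + q * y i) := by
  have key : ∀ (x y z : ι → ℝ) (r s t : ℝ), r ≠ 0 → (s / r ≤ 0) → (t / r ≤ 0) →
      (∀ i, r * x i + s * y i + t * z i = 0) →
      (∃ p q : ℝ, 0 ≤ p ∧ 0 ≤ q ∧ ∀ i, x i = p * y i + q * z i) := by
    intro x y z r s t hr hs ht h
    refine ⟨-(s / r), -(t / r), by linarith, by linarith, fun i => ?_⟩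
    field_simp
    linarith [h i]
  have key0 : ∀ (x y z : ι → ℝ) (r s t : ℝ), (∀ i, 0 ≤ x i) → (∀ i, 0 ≤ y i) →
      (∀ i, 0 ≤ z i) → r ≠ 0 → (0 ≤ s / r) → (0 ≤ t / r) →
      (∀ i, r * x i + s * y i + t * z i = 0) →
      (∃ p q : ℝ, 0 ≤ p ∧ 0 ≤ q ∧ ∀ i, x i = p * y i + q * z i) := by
    intro x y z r s t hx hy hz hr hs ht h
    refine ⟨0, 0, le_rfl, le_rfl, fun i => ?_⟩
    have h1 : x i + s / r * y i + t / r * z i = 0 := by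
      field_simp
      linarith [h i]
    have := mul_nonneg hs (hy i)
    have := mul_nonneg ht (hz i)
    linarith [hx i]
  have hyp2 : ∀ i, s * y i + r * x i + t * z i = 0 := fun i => by linarith [h i]
  have hyp3 : ∀ i, t * z i + r * x i + s * y i = 0 := fun i => by linarith [h i]
  by_cases hr : r = 0
  · by_cases hs : s = 0
    · have ht : t ≠ 0 := by tauto
      right; right
      exact key z x y t r s ht (by simp [hr]) (by simp [hs]) hyp3
    · right; left
      rcases le_total (t / s) 0 with h1 | h1
      · exact key y x z s r t hs (by simp [hr]) h1 hyp2
      · exact key0 y x z s r t hy hx hz hs (by simp [hr]) h1 hyp2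
  · rcases le_total (s / r) 0 with h1 | h1 <;> rcases le_total (t / r) 0 with h2 | h2
    · left; exact key x y z r s t hr h1 h2 h
    · by_cases hs : s = 0
      · left; exact key0 x y z r s t hx hy hz hr (by simp [hs]) h2 h
      · right; left
        have e1 : r / s ≤ 0 := by rw [← inv_div]; exact inv_nonpos.2 h1
        refine key y x z s r t hs e1 ?_ hyp2
        have : t / s = (t / r) * (r / s) := by field_simp
        rw [this]; exact mul_nonpos_of_nonneg_of_nonpos h2 e1
    · by_cases ht : t = 0
      · left; exact key0 x y z r s t hx hy hz hr h1 (by simp [ht]) h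
      · right; right
        have e1 : r / t ≤ 0 := by rw [← inv_div]; exact inv_nonpos.2 h2
        refine key z x y t r s ht e1 ?_ hyp3
        have : s / t = (s / r) * (r / t) := by field_simp
        rw [this]; exact mul_nonpos_of_nonneg_of_nonpos h1 e1
    · left; exact key0 x y z r s t hx hy hz hr h1 h2 h

/-- Rank at most two gives a linear relation among any three columns. -/
lemma aux_dep {m n : ℕ} (P : Matrix (Fin m) (Fin n) ℝ) (hrk : P.rank ≤ 2) (j k l : Fin n) :
    ∃ r s t : ℝ, (r ≠ 0 ∨ s ≠ 0 ∨ t ≠ 0) ∧ ∀ i, r * P i j + s * P i k + t * P i l = 0 := by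
  have hnot : ¬ LinearIndependent ℝ (fun e : Fin 3 => P.col (![j, k, l] e)) := by
    intro hli
    have h1 := finrank_span_eq_card hli
    have h2 : Submodule.span ℝ (Set.range (fun e : Fin 3 => P.col (![j, k, l] e))) ≤
        Submodule.span ℝ (Set.range P.col) := by
      apply Submodule.span_mono
      rintro _ ⟨e, rfl⟩
      exact ⟨_, rfl⟩
    have h3 := Submodule.finrank_mono h2
    rw [Matrix.rank_eq_finrank_span_cols] at hrk
    simp at h1
    omega
  rw [Fintype.not_linearIndependent_iff] at hnot
  obtain ⟨g, hg, e, he⟩ := hnot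
  refine ⟨g 0, g 1, g 2, ?_, fun i => ?_⟩
  · fin_cases e
    · left; exact he
    · right; left; exact he
    · right; right; exact he
  · have := congrFun hg i
    simpa [Fin.sum_univ_three, Matrix.col] using this

lemma aux_cone {m J : ℕ} (P : Matrix (Fin m) (Fin (J + 2)) ℝ) (hpos : ∀ i j, 0 ≤ P i j)
    (hrk : P.rank ≤ 2) (S : Finset (Fin (J + 2))) :
    ∃ j₁ j₂ : Fin (J + 2), j₁ ≠ j₂ ∧ ∀ j ∈ S, ∃ p q : ℝ, 0 ≤ p ∧ 0 ≤ q ∧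
      ∀ i, P i j = p * P i j₁ + q * P i j₂ := by
  induction S using Finset.induction_on with
  | empty => exact ⟨0, 1, by simp [Fin.ext_iff], by simp⟩
  | insert k S hk ih =>
    obtain ⟨j₁, j₂, hne, h⟩ := ih
    by_cases hk1 : k = j₁
    · refine ⟨j₁, j₂, hne, fun j hj => ?_⟩
      rcases Finset.mem_insert.1 hj with rfl | hj
      · exact ⟨1, 0, by simp, by simp, by simp [hk1]⟩
      · exact h j hj
    by_cases hk2 : k = j₂
    · refine ⟨j₁, j₂, hne, fun j hj => ?_⟩
      rcases Finset.mem_insert.1 hj with rfl | hj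
      · exact ⟨0, 1, by simp, by simp, by simp [hk2]⟩
      · exact h j hj
    obtain ⟨r, s, t, hn, hrel⟩ := aux_dep P hrk j₁ j₂ k
    rcases aux_three (fun i => P i j₁) (fun i => P i j₂) (fun i => P i k)
      (fun i => hpos i _) (fun i => hpos i _) (fun i => hpos i _) r s t hn hrel with
      ⟨p, q, hp, hq, e⟩ | ⟨p, q, hp, hq, e⟩ | ⟨p, q, hp, hq, e⟩
    · refine ⟨j₂, k, Ne.symm hk2, fun j hj => ?_⟩
      rcases Finset.mem_insert.1 hj with rfl | hj
      · exact ⟨0, 1, by simp, by simp, by simp⟩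
      · obtain ⟨p', q', hp', hq', e'⟩ := h j hj
        refine ⟨p' * p + q', p' * q, by positivity, by positivity, fun i => ?_⟩
        have h3 := e i
        rw [e' i]
        linear_combination p' * h3
    · refine ⟨j₁, k, Ne.symm hk1, fun j hj => ?_⟩
      rcases Finset.mem_insert.1 hj with rfl | hj
      · exact ⟨0, 1, by simp, by simp, by simp⟩
      · obtain ⟨p', q', hp', hq', e'⟩ := h j hj
        refine ⟨p' + q' * p, q' * q, by positivity, by positivity, fun i => ?_⟩
        have h3 := e i
        rw [e' i]
        linear_combination q' * h3
    · refine ⟨j₁, j₂, hne, fun j hj => ?_⟩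
      rcases Finset.mem_insert.1 hj with rfl | hj
      · exact ⟨p, q, hp, hq, e⟩
      · exact h j hj

lemma aux_cone_lt {m J : ℕ} (P : Matrix (Fin m) (Fin (J + 2)) ℝ) (hpos : ∀ i j, 0 ≤ P i j)
    (hrk : P.rank ≤ 2) :
    ∃ j₁ j₂ : Fin (J + 2), j₁ < j₂ ∧ ∃ p q : Fin (J + 2) → ℝ, (∀ j, 0 ≤ p j) ∧ (∀ j, 0 ≤ q j) ∧
      p j₁ = 1 ∧ p j₂ = 0 ∧ q j₁ = 0 ∧ q j₂ = 1 ∧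
      ∀ i j, P i j = P i j₁ * p j + P i j₂ * q j := by
  have main : ∃ j₁ j₂ : Fin (J + 2), j₁ < j₂ ∧ ∀ j, ∃ p q : ℝ, 0 ≤ p ∧ 0 ≤ q ∧
      ∀ i, P i j = p * P i j₁ + q * P i j₂ := by
    obtain ⟨j₁, j₂, hne, h⟩ := aux_cone P hpos hrk Finset.univ
    rcases lt_or_gt_of_ne hne with hlt | hlt
    · exact ⟨j₁, j₂, hlt, fun j => h j (Finset.mem_univ _)⟩
    · refine ⟨j₂, j₁, hlt, fun j => ?_⟩
      obtain ⟨p, q, hp, hq, e⟩ := h j (Finset.mem_univ _)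
      exact ⟨q, p, hq, hp, fun i => by rw [e i]; ring⟩
  obtain ⟨j₁, j₂, hlt, h⟩ := main
  choose p q hp hq e using h
  refine ⟨j₁, j₂, hlt, fun j => if j = j₁ then 1 else if j = j₂ then 0 else p j,
    fun j => if j = j₁ then 0 else if j = j₂ then 1 else q j, ?_, ?_, ?_, ?_, ?_, ?_, ?_⟩
  · intro j
    dsimp only
    split_ifs <;> simp [hp]
  · intro j
    dsimp only
    split_ifs <;> simp [hq]
  · simp
  · simp [hlt.ne']
  · simp
  · simp [hlt.ne']
  · intro i j
    dsimp only
    split_ifs with h1 h2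
    · simp [h1]
    · simp [h2]
    · rw [e j i]; ring

lemma aux_col {I : ℕ} (x : Fin (I + 1) → ℝ) (hx : ∀ i, 0 ≤ x i) :
    ∃ a : Fin I → ℝ, (∀ i, 0 ≤ a i ∧ a i ≤ 1) ∧ (0 ≤ ∑ i, a i ∧ ∑ i, a i ≤ 1) ∧
      ∀ i, (∑ k, x k) * colVec a i = x i := by
  by_cases hs : ∑ k, x k = 0
  · refine ⟨0, by simp, by simp, fun i => ?_⟩
    rw [hs, zero_mul]
    exact ((Finset.sum_eq_zero_iff_of_nonneg (fun i _ => hx i)).1 hs i (Finset.mem_univ _)).symm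
  · have hs0 : 0 ≤ ∑ k, x k := Finset.sum_nonneg fun i _ => hx i
    have ha : ∀ i : Fin I, 0 ≤ x i.castSucc / ∑ k, x k := fun i => div_nonneg (hx _) hs0
    have hle : ∑ i : Fin I, x i.castSucc / ∑ k, x k ≤ 1 := by
      rw [← Finset.sum_div, div_le_one (lt_of_le_of_ne hs0 (Ne.symm hs)), Fin.sum_univ_castSucc]
      linarith [hx (Fin.last I)]
    refine ⟨fun i => x i.castSucc / ∑ k, x k, fun i => ⟨ha i, ?_⟩,
      ⟨Finset.sum_nonneg fun i _ => ha i, hle⟩, fun i => ?_⟩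
    · exact (Finset.single_le_sum (f := fun i : Fin I => x i.castSucc / ∑ k, x k)
        (fun i _ => ha i) (Finset.mem_univ i)).trans hle
    · refine Fin.lastCases ?_ (fun i => ?_) i
      · simp only [colVec, Fin.snoc_last]
        rw [← Finset.sum_div, mul_sub, mul_div_cancel₀ _ hs, Fin.sum_univ_castSucc]
        ring
      · simp only [colVec, Fin.snoc_castSucc]
        rw [mul_div_cancel₀ _ hs]

lemma aux_row {J : ℕ} (j₁ j₂ : Fin (J + 2)) (h : j₁ < j₂) (p : Fin (J + 2) → ℝ)
    (hp : ∀ j, 0 ≤ p j) (hS : 0 < ∑ j, p j) :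
    ∃ b : Fin J → ℝ, (∀ i, 0 ≤ b i ∧ b i ≤ 1) ∧ (0 ≤ ∑ i, b i ∧ ∑ i, b i ≤ 1) ∧
      (1 - ∑ i, b i) * (∑ j, p j) = p j₁ + p j₂ ∧
      ∀ x₁ x₂ j, (∑ j, p j) * rowGen j₁ j₂ h x₁ x₂ b j =
        if j = j₁ then (∑ j, p j) * x₁ else if j = j₂ then (∑ j, p j) * x₂ else p j := by
  set T := (Finset.univ.erase j₁).erase j₂ with hT
  set o := T.orderIsoOfFin (card_erase_two j₁ j₂ h) with ho
  have hsumT : ∑ k : Fin J, p (o k) = ∑ j ∈ T, p j := by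
    rw [← Finset.sum_coe_sort T]
    exact Equiv.sum_comp o.toEquiv (fun j : T => p j)
  have hsum : ∑ j, p j = p j₁ + p j₂ + ∑ k : Fin J, p (o k) := by
    rw [hsumT, ← Finset.add_sum_erase Finset.univ p (Finset.mem_univ j₁),
      ← Finset.add_sum_erase (Finset.univ.erase j₁) p (a := j₂) (by simp [h.ne']), hT]
    ring
  have hb : ∀ k, 0 ≤ p (o k) / ∑ j, p j := fun k => div_nonneg (hp _) hS.le
  have hle : ∑ k : Fin J, p (o k) / ∑ j, p j ≤ 1 := by
    rw [← Finset.sum_div, div_le_one hS]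
    linarith [hp j₁, hp j₂]
  refine ⟨fun k => p (o k) / ∑ j, p j, fun k => ⟨hb k, ?_⟩,
      ⟨Finset.sum_nonneg fun i _ => hb i, hle⟩, ?_, ?_⟩
  · exact (Finset.single_le_sum (f := fun k : Fin J => p (o k) / ∑ j, p j)
        (fun i _ => hb i) (Finset.mem_univ k)).trans hle
  · rw [← Finset.sum_div, sub_mul, div_mul_cancel₀ _ hS.ne']
    linarith
  · intro x₁ x₂ j
    unfold rowGen
    split_ifs with h1 h2
    · rfl
    · rfl
    · rw [mul_div_cancel₀ _ hS.ne']
      exact congrArg (fun y : T => p y) (o.apply_symm_apply _)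

/-- the set M of probability matrices of rank at most 2 is covered by the
images of the maps f_{j₁,j₂}: for every P ∈ M there are indices j₁ < j₂ and a parameter
point in U'_{j₁,j₂} mapping to P. -/
theorem model_covered_by_charts {I J : ℕ} (hIJ : I + 1 ≤ J + 2)
    (P : Matrix (Fin (I + 1)) (Fin (J + 2)) ℝ)
    (hpos : ∀ i j, 0 ≤ P i j) (hsum : ∑ i, ∑ j, P i j = 1)
    (hrk : P.rank ≤ 2) :
    ∃ (j₁ j₂ : Fin (J + 2)) (h : j₁ < j₂)
      (a : Fin I → ℝ) (b : Fin J → ℝ) (c : Fin I → ℝ) (d : Fin J → ℝ) (α : ℝ),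
      memU a b c d α ∧ fGen j₁ j₂ h a b c d α = P := by
  obtain ⟨j₁, j₂, h, p, q, hp, hq, hp1, hp2, hq1, hq2, e⟩ := aux_cone_lt P hpos hrk
  have hSp : 0 < ∑ j, p j := by
    have := Finset.single_le_sum (fun i _ => hp i) (Finset.mem_univ j₁)
    linarith
  have hSq : 0 < ∑ j, q j := by
    have := Finset.single_le_sum (fun i _ => hq i) (Finset.mem_univ j₂)
    linarith
  obtain ⟨a, ha, hasum, hae⟩ := aux_col (fun i => P i j₁) (fun i => hpos i j₁)
  obtain ⟨c, hc, hcsum, hce⟩ := aux_col (fun i => P i j₂) (fun i => hpos i j₂)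
  obtain ⟨b, hb, hbsum, hbe, hbr⟩ := aux_row j₁ j₂ h p hp hSp
  obtain ⟨d, hd, hdsum, hde, hdr⟩ := aux_row j₁ j₂ h q hq hSq
  have hs1 : 0 ≤ ∑ i, P i j₁ := Finset.sum_nonneg fun i _ => hpos i _
  have hs2 : 0 ≤ ∑ i, P i j₂ := Finset.sum_nonneg fun i _ => hpos i _
  have htot : (∑ i, P i j₁) * (∑ j, p j) + (∑ i, P i j₂) * (∑ j, q j) = 1 := by
    rw [← hsum, Finset.sum_mul_sum, Finset.sum_mul_sum, ← Finset.sum_add_distrib]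
    refine Finset.sum_congr rfl fun i _ => ?_
    rw [← Finset.sum_add_distrib]
    exact Finset.sum_congr rfl fun j _ => (e i j).symm
  have hα : 1 - (∑ i, P i j₁) * (∑ j, p j) = (∑ i, P i j₂) * (∑ j, q j) := by linarith
  have hrowp : ∀ j, (∑ j, p j) * rowGen j₁ j₂ h (1 - ∑ k, b k) 0 b j = p j := by
    intro j
    rw [hbr]
    split_ifs with h1 h2
    · rw [h1]; linarith
    · rw [h2]; linarith
    · rfl
  have hrowq : ∀ j, (∑ j, q j) * rowGen j₁ j₂ h 0 (1 - ∑ k, d k) d j = q j := by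
    intro j
    rw [hdr]
    split_ifs with h1 h2
    · rw [h1]; linarith
    · rw [h2]; linarith
    · rfl
  refine ⟨j₁, j₂, h, a, b, c, d, (∑ i, P i j₁) * (∑ j, p j),
    ⟨ha, hb, hc, hd, ⟨mul_nonneg hs1 hSp.le, ?_⟩, hasum, hbsum, hcsum, hdsum⟩, ?_⟩
  · have := mul_nonneg hs2 hSq.le
    linarith
  · ext i j
    unfold fGen
    rw [hα, e i j]
    linear_combination ((∑ i, P i j₁) * colVec a i) * hrowp j + p j * hae i +
      ((∑ i, P i j₂) * colVec c i) * hrowq j + q j * hce i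
end

section
/- Let P' = (a_1,…,a_{I−1}, b_3,…,b_J, c_1,…,c_{I−1}, d_3,…,d_J, α) ∈ U'_{1,2} and P = f_{1,2}(P'). If some coefficient a_i equals zero, or some coefficient c_i equals zero, or Σ a_i = 1, or Σ b_i = 1, then the matrix P has at least one entry equal to zero; consequently every neighborhood of P in the space of real I×J matrices contains matrices with a negative entry, so P does not lie in the interior of the set of nonnegative matrices. -/
/-- Row vector (1 - Σ b_i, 0, b_3, …, b_J) ∈ ℝ^{J+2}. -/
def rowVecB {J : ℕ} (b : Fin J → ℝ) : Fin (J + 2) → ℝ :=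
  Fin.cons (1 - ∑ j, b j) (Fin.cons 0 b)

/-- Row vector (0, 1 - Σ d_i, d_3, …, d_J) ∈ ℝ^{J+2}. -/
def rowVecD {J : ℕ} (d : Fin J → ℝ) : Fin (J + 2) → ℝ :=
  Fin.cons 0 (Fin.cons (1 - ∑ j, d j) d)

/-- The parametrization map f_{1,2}: sends the parameter point
(a, b, c, d, α) to the (I+1) × (J+2) matrix α·u·vᵗ + (1-α)·w·zᵗ. -/
def f12 {I J : ℕ} (a : Fin I → ℝ) (b : Fin J → ℝ) (c : Fin I → ℝ) (d : Fin J → ℝ)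
    (α : ℝ) : Matrix (Fin (I + 1)) (Fin (J + 2)) ℝ :=
  fun i j => α * colVec a i * rowVecB b j + (1 - α) * colVec c i * rowVecD d j

/-- if P' ∈ U'_{1,2} and some a_i = 0, some c_i = 0, Σ a_i = 1, or
Σ b_i = 1, then P = f_{1,2}(P') has a zero entry; consequently every neighborhood of P
contains matrices with a negative entry, so P is not interior to the nonnegative
matrices. -/
theorem f12_boundary_point {I J : ℕ} (hIJ : I + 1 ≤ J + 2)
    (a : Fin I → ℝ) (b : Fin J → ℝ) (c : Fin I → ℝ) (d : Fin J → ℝ) (α : ℝ)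
    (hU : memU a b c d α)
    (hcase : (∃ i, a i = 0) ∨ (∃ i, c i = 0) ∨ (∑ i, a i = 1) ∨ (∑ j, b j = 1)) :
    (∃ i j, f12 a b c d α i j = 0) ∧
    (∀ U : Set (Matrix (Fin (I + 1)) (Fin (J + 2)) ℝ),
      IsOpen U → f12 a b c d α ∈ U → ∃ Q ∈ U, ∃ i j, Q i j < 0) ∧
    f12 a b c d α ∉
      interior {Q : Matrix (Fin (I + 1)) (Fin (J + 2)) ℝ | ∀ i j, 0 ≤ Q i j} := by
  have hzero : ∃ i j, f12 a b c d α i j = 0 := by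
    rcases hcase with ⟨i, hi⟩ | ⟨i, hi⟩ | h | h
    · exact ⟨i.castSucc, 0, by simp [f12, colVec, rowVecD, hi]⟩
    · refine ⟨i.castSucc, 1, ?_⟩
      have h1 : rowVecB b 1 = 0 := rfl
      simp [f12, colVec, h1, hi]
    · exact ⟨Fin.last I, 0, by simp [f12, colVec, rowVecD, h]⟩
    · exact ⟨0, 0, by simp [f12, rowVecB, rowVecD, h]⟩
  have hneg : ∀ U : Set (Matrix (Fin (I + 1)) (Fin (J + 2)) ℝ),
      IsOpen U → f12 a b c d α ∈ U → ∃ Q ∈ U, ∃ i j, Q i j < 0 := by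
    intro U hUo hPU
    obtain ⟨i, j, hij⟩ := hzero
    let g : ℝ → Matrix (Fin (I + 1)) (Fin (J + 2)) ℝ :=
      fun t i j => f12 a b c d α i j - t
    have hg : Continuous g :=
      continuous_pi fun i => continuous_pi fun j => continuous_const.sub continuous_id
    have hg0 : g 0 = f12 a b c d α := by
      funext i j
      simp [g]
    have hmem : g ⁻¹' U ∈ nhds (0 : ℝ) :=
      (hUo.preimage hg).mem_nhds (by simpa [hg0] using hPU)
    obtain ⟨ε, hε, hball⟩ := Metric.mem_nhds_iff.mp hmem
    refine ⟨g (ε / 2), hball ?_, i, j, ?_⟩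
    · rw [Metric.mem_ball, Real.dist_eq, sub_zero, abs_of_pos (by linarith)]
      linarith
    · change f12 a b c d α i j - ε / 2 < 0
      rw [hij]
      linarith
  refine ⟨hzero, hneg, fun hint => ?_⟩
  obtain ⟨Q, hQ, i, j, hlt⟩ := hneg _ isOpen_interior hint
  exact absurd (interior_subset hQ i j) (not_le.mpr hlt)
end
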